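/- arXiv:2603.12812 — 14 statements merged into one kernel-verified Lean document; each statement's English description precedes it below -/
import Mathlib

section
/- Let λ0 ∈ (0, Υ(b∣C)) and suppose that ψ is differentiable at λ0 with derivative ψ'(λ0). Then, writing y0 := Π_{λ0C}(b), the derivative satisfies ⟨y0, b − y0⟩² / (λ0 · ‖y0‖ · ‖b − y0‖²) ≤ ψ'(λ0) ≤ ‖y0‖ / λ0. -/
open Pointwise RealInnerProductSpace

/-- The gauge `Υ(b ∣ C) := inf {λ ≥ 0 : b ∈ λ • C}`. -/
noncomputable def gaugeAt {p : ℕ} (C : Set (EuclideanSpace ℝ (Fin p)))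
    (b : EuclideanSpace ℝ (Fin p)) : ℝ :=
  sInf {r : ℝ | 0 ≤ r ∧ b ∈ r • C}

section Projection

variable {E : Type*} [NormedAddCommGroup E] [InnerProductSpace ℝ E]

/-- Variational inequality for a nearest point `l • c` to `b` in the dilate `l • C`. -/
lemma inner_sub_nonpos_of_nearest_smul {C : Set E} (hC : Convex ℝ C) {b c : E} {l : ℝ}
    (hl : 0 < l) (hc : c ∈ C) (hmin : ∀ w ∈ l • C, ‖b - l • c‖ ≤ ‖b - w‖)
    {w : E} (hw : w ∈ C) : ⟪b - l • c, w - c⟫ ≤ 0 := by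
  have hmem : l • c ∈ l • C := Set.smul_mem_smul_set hc
  have hinf : ‖b - l • c‖ = ⨅ v : (l • C : Set E), ‖b - v‖ := by
    have : Nonempty (l • C : Set E) := ⟨⟨_, hmem⟩⟩
    refine le_antisymm (le_ciInf fun v => hmin v v.2) ?_
    exact ciInf_le (f := fun v : (l • C : Set E) => ‖b - v‖)
      ⟨0, by rintro _ ⟨v, rfl⟩; exact norm_nonneg _⟩ ⟨l • c, hmem⟩
  have h := (norm_eq_iInf_iff_real_inner_le_zero (hC.smul l) hmem).1 hinf
    (l • w) (Set.smul_mem_smul_set hw)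
  rw [← smul_sub, real_inner_smul_right] at h
  exact nonpos_of_mul_nonpos_right h hl

/-- The normalized projections `Π_{lC}(b) / l` have nonincreasing norm in `l`. -/
lemma norm_le_norm_of_variational {b c c₀ : E} {l l₀ : ℝ} (hl₀ : 0 < l₀) (hl : l₀ < l)
    (h : ⟪b - l • c, c₀ - c⟫ ≤ 0) (h₀ : ⟪b - l₀ • c₀, c - c₀⟫ ≤ 0) : ‖c‖ ≤ ‖c₀‖ := by
  have hcs := real_inner_le_norm c c₀
  simp only [inner_sub_left, inner_sub_right, real_inner_smul_left,
    real_inner_self_eq_norm_sq, real_inner_comm c c₀] at h h₀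
  by_contra! hlt
  have h1 : l₀ * ‖c₀‖ ^ 2 + l * ‖c‖ ^ 2 ≤ (l₀ + l) * (‖c‖ * ‖c₀‖) := by
    nlinarith [mul_le_mul_of_nonneg_left hcs (by linarith : (0 : ℝ) ≤ l₀ + l)]
  have h2 : 0 < l * ‖c‖ - l₀ * ‖c₀‖ := by
    nlinarith [mul_pos (sub_pos.2 hl) ((norm_nonneg c₀).trans_lt hlt), mul_pos hl₀ (sub_pos.2 hlt)]
  nlinarith [mul_pos h2 (sub_pos.2 hlt)]

/-- Monotonicity of the slope of the convex function `l ↦ dist(b, lC)`. -/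
lemma inner_mul_norm_le_of_variational {b c c₀ : E} {l l₀ : ℝ} (hl₀ : 0 < l₀) (hl : l₀ < l)
    (h : ⟪b - l • c, c₀ - c⟫ ≤ 0) (h₀ : ⟪b - l₀ • c₀, c - c₀⟫ ≤ 0) :
    ⟪b - l • c, c⟫ * ‖b - l₀ • c₀‖ ≤ ⟪b - l₀ • c₀, c₀⟫ * ‖b - l • c‖ := by
  set r := b - l • c with hr
  set r₀ := b - l₀ • c₀ with hr₀
  have hcs : ⟪r, r₀⟫ ≤ ‖r‖ * ‖r₀‖ := real_inner_le_norm r r₀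
  have hcb : b = r + l • c := by simp [hr]
  have e₀ : r₀ = r + l • c - l₀ • c₀ := by rw [← hcb]
  have e : r = r₀ + l₀ • c₀ - l • c := by rw [e₀]; abel
  have i1 : ⟪r, r₀⟫ = ‖r‖ ^ 2 + l * ⟪r, c⟫ - l₀ * ⟪r, c₀⟫ := by
    conv_lhs => rw [e₀]
    simp only [inner_sub_right, inner_add_right, real_inner_smul_right, real_inner_self_eq_norm_sq]
  have i2 : ⟪r, r₀⟫ = ‖r₀‖ ^ 2 + l₀ * ⟪r₀, c₀⟫ - l * ⟪r₀, c⟫ := by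
    rw [real_inner_comm]
    conv_lhs => rw [e]
    simp only [inner_sub_right, inner_add_right, real_inner_smul_right, real_inner_self_eq_norm_sq]
  rw [inner_sub_right] at h h₀
  have j1 : ‖r‖ ^ 2 + (l - l₀) * ⟪r, c⟫ ≤ ‖r‖ * ‖r₀‖ := by nlinarith
  have j2 : ‖r₀‖ ^ 2 + (l₀ - l) * ⟪r₀, c₀⟫ ≤ ‖r‖ * ‖r₀‖ := by nlinarith
  have k : (l - l₀) * (⟪r, c⟫ * ‖r₀‖ - ⟪r₀, c₀⟫ * ‖r‖) ≤ 0 := by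
    nlinarith [mul_le_mul_of_nonneg_right j1 (norm_nonneg r₀),
      mul_le_mul_of_nonneg_right j2 (norm_nonneg r)]
  linarith [nonpos_of_mul_nonpos_right k (sub_pos.2 hl)]

/-- Lower bound for `‖l • c‖ ^ 2` by a polynomial in `l`. -/
lemma le_norm_sq_of_variational {b c c₀ : E} {l l₀ : ℝ} (hl₀ : 0 < l₀) (hl : l₀ < l)
    (h : ⟪b - l • c, c₀ - c⟫ ≤ 0) (h₀ : ⟪b - l₀ • c₀, c - c₀⟫ ≤ 0)
    (hmin : ‖b - l • c‖ ≤ ‖b - l • c₀‖) (hnonneg : 0 ≤ ⟪b - l₀ • c₀, c₀⟫)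
    (hne : 0 < ‖b - l₀ • c₀‖) :
    ‖b‖ ^ 2 - l * (⟪b - l₀ • c₀, c₀⟫ / ‖b - l₀ • c₀‖ ^ 2) *
        (‖b - l • c₀‖ ^ 2 + ‖b - l₀ • c₀‖ ^ 2) - ‖b - l • c₀‖ ^ 2 ≤ ‖l • c‖ ^ 2 := by
  have hmono := inner_mul_norm_le_of_variational hl₀ hl h h₀
  have hb : ‖b‖ ^ 2 = ‖b - l • c‖ ^ 2 + 2 * (l * ⟪b - l • c, c⟫) + ‖l • c‖ ^ 2 := by
    rw [← real_inner_smul_right, ← norm_add_sq_real, sub_add_cancel]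
  set t := ‖b - l • c‖
  set t₀ := ‖b - l₀ • c₀‖
  set q := ‖b - l • c₀‖
  set a := ⟪b - l₀ • c₀, c₀⟫
  have ht : t ^ 2 ≤ q ^ 2 := pow_le_pow_left₀ (norm_nonneg _) hmin 2
  have key : 2 * ⟪b - l • c, c⟫ ≤ a / t₀ ^ 2 * (q ^ 2 + t₀ ^ 2) := by
    rw [div_mul_eq_mul_div, le_div_iff₀ (by positivity)]
    have hag : 2 * (t * t₀) ≤ q ^ 2 + t₀ ^ 2 := by nlinarith [sq_nonneg (t - t₀)]
    nlinarith [mul_le_mul_of_nonneg_right hmono hne.le, mul_le_mul_of_nonneg_left hag hnonneg]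
  nlinarith [mul_le_mul_of_nonneg_left key (hl₀.trans hl).le]

end Projection

lemma HasDerivAt.nonneg_of_forall_gt {f : ℝ → ℝ} {f' x : ℝ} (hf : HasDerivAt f f' x)
    (h : ∀ y, x < y → f x ≤ f y) : 0 ≤ f' := by
  have ht := (hasDerivWithinAt_iff_tendsto_slope' (s := Set.Ioi x) (by simp)).1
    hf.hasDerivWithinAt
  refine ge_of_tendsto ht ?_
  filter_upwards [self_mem_nhdsWithin] with y hy
  rw [slope_def_field]
  exact div_nonneg (sub_nonneg.2 (h y hy)) (sub_nonneg.2 (le_of_lt hy))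

/-- If `ψ(λ) = ‖Π_{λC}(b)‖` is differentiable at `λ0 ∈ (0, Υ(b∣C))` with derivative `d`,
then `⟨y0, b − y0⟩² / (λ0 ‖y0‖ ‖b − y0‖²) ≤ d ≤ ‖y0‖ / λ0` where `y0 = Π_{λ0 C}(b)`. -/
theorem derivative_bounds {p : ℕ} (hp : 0 < p)
    (C : Set (EuclideanSpace ℝ (Fin p))) (b : EuclideanSpace ℝ (Fin p))
    (hCclosed : IsClosed C) (hCconv : Convex ℝ C)
    (h0C : (0 : EuclideanSpace ℝ (Fin p)) ∈ C)
    (hfin : {r : ℝ | 0 ≤ r ∧ b ∈ r • C}.Nonempty)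
    (hpos : 0 < gaugeAt C b)
    (P : ℝ → EuclideanSpace ℝ (Fin p))
    (hP : ∀ l : ℝ, 0 < l → P l ∈ l • C ∧ ∀ w ∈ l • C, ‖b - P l‖ ≤ ‖b - w‖)
    (ψ : ℝ → ℝ) (hψ : ∀ l, ψ l = ‖P l‖)
    (l0 d : ℝ) (hl0 : l0 ∈ Set.Ioo 0 (gaugeAt C b))
    (hderiv : HasDerivAt ψ d l0) :
    ⟪P l0, b - P l0⟫ ^ 2 / (l0 * ‖P l0‖ * ‖b - P l0‖ ^ 2) ≤ d ∧ d ≤ ‖P l0‖ / l0 := by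
  obtain ⟨hl0pos, hl0lt⟩ := hl0
  have hrep : ∀ l, 0 < l → ∃ c ∈ C, P l = l • c := fun l hl => by
    obtain ⟨c, hc, hcl⟩ := (hP l hl).1
    exact ⟨c, hc, hcl.symm⟩
  obtain ⟨c₀, hc₀, hPc₀⟩ := hrep l0 hl0pos
  have hmin₀ := (hP l0 hl0pos).2
  rw [hPc₀] at hmin₀
  have hvar₀ : ∀ w ∈ C, ⟪b - l0 • c₀, w - c₀⟫ ≤ 0 := fun w hw =>
    inner_sub_nonpos_of_nearest_smul hCconv hl0pos hc₀ hmin₀ hw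
  have hvar : ∀ l, l0 < l → ∃ c ∈ C, P l = l • c ∧ ⟪b - l • c, c₀ - c⟫ ≤ 0 ∧
      ‖b - l • c‖ ≤ ‖b - l • c₀‖ := fun l hl => by
    have hlpos := hl0pos.trans hl
    obtain ⟨c, hc, hPc⟩ := hrep l hlpos
    have hmin := (hP l hlpos).2
    rw [hPc] at hmin
    exact ⟨c, hc, hPc, inner_sub_nonpos_of_nearest_smul hCconv hlpos hc hmin hc₀,
      hmin _ (Set.smul_mem_smul_set hc₀)⟩
  have hne : 0 < ‖b - l0 • c₀‖ := by
    rw [norm_pos_iff, sub_ne_zero]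
    intro hb
    refine absurd hl0lt (not_lt.2 (csInf_le ⟨0, fun r hr => hr.1⟩ ⟨hl0pos.le, ?_⟩))
    exact ⟨c₀, hc₀, hb.symm⟩
  have hψ₀ : ψ l0 = l0 * ‖c₀‖ := by
    rw [hψ, hPc₀, norm_smul, Real.norm_of_nonneg hl0pos.le]
  constructor
  · rcases eq_or_ne (P l0) 0 with hP0 | hP0
    · rw [hP0, inner_zero_left]
      simp only [norm_zero, mul_zero, zero_mul, div_zero]
      exact hderiv.nonneg_of_forall_gt fun l _ => by
        rw [hψ, hψ, hP0, norm_zero]; exact norm_nonneg _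
    have hnonneg : 0 ≤ ⟪b - l0 • c₀, c₀⟫ := by
      simpa using hvar₀ 0 h0C
    set t₀ := ‖b - l0 • c₀‖ with ht₀
    set a := ⟪b - l0 • c₀, c₀⟫ with ha
    have hq : ∀ l : ℝ, ‖b - l • c₀‖ ^ 2 = ‖b‖ ^ 2 - 2 * l * ⟪b, c₀⟫ + l ^ 2 * ‖c₀‖ ^ 2 := by
      intro l
      rw [norm_sub_sq_real, real_inner_smul_right, norm_smul, mul_pow, Real.norm_eq_abs, sq_abs]
      ring
    have ha' : a = ⟪b, c₀⟫ - l0 * ‖c₀‖ ^ 2 := by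
      rw [ha, inner_sub_left, real_inner_smul_left, real_inner_self_eq_norm_sq]
    have hqd : HasDerivAt (fun l : ℝ => ‖b - l • c₀‖ ^ 2) (-2 * a) l0 := by
      simp only [hq]
      have h1 := ((((hasDerivAt_id l0).const_mul 2).mul_const ⟪b, c₀⟫).const_sub (‖b‖ ^ 2)).add
        (((hasDerivAt_id l0).pow 2).mul_const (‖c₀‖ ^ 2))
      refine h1.congr_deriv ?_
      simp only [id, ha']
      push_cast
      ring
    have hG := (((((hasDerivAt_id l0).mul_const (a / t₀ ^ 2)).mul
      (hqd.add_const (t₀ ^ 2))).const_sub (‖b‖ ^ 2)).sub hqd)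
    have hF := (hderiv.pow 2).sub hG
    have hF0 := hF.nonneg_of_forall_gt fun l hl => by
      obtain ⟨c, hc, hPc, hv, hm⟩ := hvar l hl
      have hle := le_norm_sq_of_variational hl0pos hl hv (hvar₀ c hc) hm hnonneg hne
      have heq : ‖b‖ ^ 2 - l0 * (a / t₀ ^ 2) * (t₀ ^ 2 + t₀ ^ 2) - t₀ ^ 2 = ψ l0 ^ 2 := by
        have : l0 * (a / t₀ ^ 2) * (t₀ ^ 2 + t₀ ^ 2) = 2 * l0 * a := by field_simp; ring
        rw [this, hψ₀, ht₀, hq, ha']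
        ring
      simp only [Pi.sub_apply, Pi.mul_apply, Pi.pow_apply, id]
      rw [hψ l, hPc, ← heq]
      linarith
    have hPpos : 0 < ‖P l0‖ := norm_pos_iff.2 hP0
    have hmain : l0 * a ^ 2 / t₀ ^ 2 ≤ ‖P l0‖ * d := by
      have e : l0 * (a / t₀ ^ 2) * (-2 * a) = -2 * (l0 * a ^ 2 / t₀ ^ 2) := by ring
      have e' : 1 * (a / t₀ ^ 2) * (t₀ ^ 2 + t₀ ^ 2) = 2 * a := by field_simp; ring
      simp only [id, ← ht₀, e, e', hψ] at hF0
      norm_num at hF0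
      linarith
    have hin : ⟪P l0, b - P l0⟫ = l0 * a := by
      rw [hPc₀, real_inner_smul_left, real_inner_comm]
    rw [hin, show ‖b - P l0‖ = t₀ by rw [hPc₀]]
    rw [div_le_iff₀ (by positivity)] at hmain ⊢
    nlinarith [mul_le_mul_of_nonneg_left hmain hl0pos.le]
  · have hF := ((hasDerivAt_id l0).mul_const ‖c₀‖).sub hderiv
    have hF0 := hF.nonneg_of_forall_gt fun l hl => by
      obtain ⟨c, hc, hPc, hv, -⟩ := hvar l hl
      have hle := norm_le_norm_of_variational hl0pos hl hv (hvar₀ c hc)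
      have hlpos := hl0pos.trans hl
      simp only [Pi.sub_apply, id]
      rw [hψ₀, hψ l, hPc, norm_smul, Real.norm_of_nonneg hlpos.le]
      nlinarith
    rw [← hψ, hψ₀, mul_div_cancel_left₀ _ hl0pos.ne']
    linarith
end

section
/- For every λ̄ ∈ (0, Υ(b∣C)) there exist ε > 0 and constants 0 < m ≤ M < +∞ such that for every λ ∈ (λ̄ − ε, λ̄ + ε) at which ψ is differentiable, the derivative satisfies m ≤ ψ'(λ) ≤ M. (In particular, every element of the Clarke generalized Jacobian ∂ψ(λ̄), being a convex combination of limits of such derivatives, is a positive real number.) -/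
open Pointwise RealInnerProductSpace

section InnerProductSpace

variable {E : Type*} [NormedAddCommGroup E] [InnerProductSpace ℝ E]

/-- Variational inequality for a nearest point of a dilate `l • C`, scaled back to `C`. -/
theorem inner_sub_smul_le_zero_of_nearest {C : Set E} (hC : Convex ℝ C) {b u : E} {l : ℝ}
    (hl : 0 < l) (hu : u ∈ C) (hmin : ∀ w ∈ l • C, ‖b - l • u‖ ≤ ‖b - w‖) :
    ∀ w ∈ C, ⟪b - l • u, w - u⟫ ≤ 0 := by
  intro w hw
  have hlu : l • u ∈ l • C := Set.smul_mem_smul_set hu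
  have hinf : ‖b - l • u‖ = ⨅ w : (l • C : Set E), ‖b - w‖ := by
    have : Nonempty (l • C : Set E) := ⟨⟨_, hlu⟩⟩
    refine le_antisymm (le_ciInf fun w => hmin w w.2) ?_
    exact ciInf_le ⟨0, by rintro _ ⟨w, rfl⟩; exact norm_nonneg _⟩ (⟨_, hlu⟩ : (l • C : Set E))
  have h := (norm_eq_iInf_iff_real_inner_le_zero (hC.smul l) hlu).1 hinf _
    (Set.smul_mem_smul_set hw)
  rw [← smul_sub, inner_smul_right] at h
  exact nonpos_of_mul_nonpos_right h hl

theorem mul_norm_sub_sq_le_of_variational {b u v : E} {l m : ℝ} (hl : 0 < l) (hm : 0 < m)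
    (hu : ⟪b - l • u, v - u⟫ ≤ 0) (hv : ⟪b - m • v, u - v⟫ ≤ 0) :
    l * ‖m • v - l • u‖ ^ 2 ≤ (m - l) * ⟪l • u, m • v - l • u⟫ := by
  rw [← real_inner_self_eq_norm_sq]
  simp only [inner_sub_left, inner_sub_right, real_inner_smul_left, real_inner_smul_right] at *
  rw [real_inner_comm u v] at *
  have h : 0 ≤ l * (⟪u, v⟫ - ⟪u, u⟫) + m * (⟪u, v⟫ - ⟪v, v⟫) := by linarith
  nlinarith [mul_nonneg (mul_pos hl hm).le h]

theorem mul_norm_sub_le_of_variational {c u v : E} {l m r : ℝ} (hl : 0 ≤ l) (hlm : l ≤ m)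
    (hmr : m ≤ r) (hu : ⟪r • c - m • v, u - v⟫ ≤ 0) (hc : ⟪r • c - m • v, c - v⟫ ≤ 0) :
    (m - l) * ‖r • c - m • v‖ ≤ (r - m) * ‖m • v - l • u‖ := by
  set d := r • c - m • v with hd
  rw [inner_sub_right] at hu hc
  have hy : ⟪d, m • v - l • u⟫ = m * ⟪d, v⟫ - l * ⟪d, u⟫ := by
    simp only [inner_sub_right, real_inner_smul_right]
  have hdd : ‖d‖ ^ 2 = r * ⟪d, c⟫ - m * ⟪d, v⟫ := by
    rw [← real_inner_self_eq_norm_sq]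
    nth_rewrite 2 [hd]
    simp only [inner_sub_right, real_inner_smul_right]
  have h1 : (m - l) * ⟪d, v⟫ ≤ ⟪d, m • v - l • u⟫ := by rw [hy]; nlinarith
  have h2 : ‖d‖ ^ 2 ≤ (r - m) * ⟪d, v⟫ := by rw [hdd]; nlinarith
  have h3 := real_inner_le_norm d (m • v - l • u)
  have h4 : (m - l) * ‖d‖ ^ 2 ≤ (r - m) * (‖d‖ * ‖m • v - l • u‖) := by
    have := mul_le_mul_of_nonneg_left h2 (sub_nonneg.2 hlm)
    have := mul_le_mul_of_nonneg_left (h1.trans h3) (sub_nonneg.2 hmr)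
    nlinarith
  rcases (norm_nonneg d).eq_or_lt with h0 | h0
  · rw [← h0, mul_zero]
    exact mul_nonneg (sub_nonneg.2 hmr) (norm_nonneg _)
  · refine le_of_mul_le_mul_right ?_ h0
    linarith

end InnerProductSpace

theorem deriv_mem_Icc_of_forall_lt {f : ℝ → ℝ} {s t m M x : ℝ} (hx : x ∈ Set.Ioo s t)
    (h : ∀ y ∈ Set.Ioo s t, x < y → m * (y - x) ≤ f y - f x ∧ f y - f x ≤ M * (y - x))
    (hf : DifferentiableAt ℝ f x) : m ≤ deriv f x ∧ deriv f x ≤ M := by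
  have hlim : Filter.Tendsto (slope f x) (nhdsWithin x (Set.Ioi x)) (nhds (deriv f x)) :=
    (hasDerivAt_iff_tendsto_slope.1 hf.hasDerivAt).mono_left
      (nhdsWithin_mono x fun y (hy : x < y) => hy.ne')
  have hev : ∀ᶠ y in nhdsWithin x (Set.Ioi x), m ≤ slope f x y ∧ slope f x y ≤ M := by
    filter_upwards [Ioo_mem_nhdsGT hx.2] with y hy
    obtain ⟨h1, h2⟩ := h y ⟨hx.1.trans hy.1, hy.2⟩ hy.1
    have hpos : 0 < y - x := sub_pos.2 hy.1
    rw [slope_def_field]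
    exact ⟨(le_div_iff₀ hpos).2 h1, (div_le_iff₀ hpos).2 h2⟩
  exact ⟨ge_of_tendsto hlim (hev.mono fun _ hy => hy.1),
    le_of_tendsto hlim (hev.mono fun _ hy => hy.2)⟩

/-- Around every `λ̄ ∈ (0, Υ(b∣C))` there is a neighborhood `(λ̄ − ε, λ̄ + ε)` and constants
`0 < m ≤ M < ∞` bounding the derivative `ψ'(λ)` at every differentiable point `λ` in the
neighborhood, where `ψ(λ) = ‖Π_{λC}(b)‖`. -/
theorem derivative_uniform_bounds {p : ℕ} (hp : 0 < p)
    (C : Set (EuclideanSpace ℝ (Fin p))) (b : EuclideanSpace ℝ (Fin p))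
    (hCclosed : IsClosed C) (hCconv : Convex ℝ C)
    (h0C : (0 : EuclideanSpace ℝ (Fin p)) ∈ C)
    (hfin : {r : ℝ | 0 ≤ r ∧ b ∈ r • C}.Nonempty)
    (hpos : 0 < gaugeAt C b)
    (P : ℝ → EuclideanSpace ℝ (Fin p))
    (hP : ∀ l : ℝ, 0 < l → P l ∈ l • C ∧ ∀ w ∈ l • C, ‖b - P l‖ ≤ ‖b - w‖)
    (ψ : ℝ → ℝ) (hψ : ∀ l, ψ l = ‖P l‖) :
    ∀ lbar ∈ Set.Ioo 0 (gaugeAt C b), ∃ ε > (0 : ℝ), ∃ m M : ℝ,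
      0 < m ∧ m ≤ M ∧
      ∀ l ∈ Set.Ioo (lbar - ε) (lbar + ε), DifferentiableAt ℝ ψ l →
        m ≤ deriv ψ l ∧ deriv ψ l ≤ M := by
  rintro lbar ⟨hlbar, hlg⟩
  obtain ⟨r, hr0, c, hcC, rfl⟩ := hfin
  have hbdd : BddBelow {s : ℝ | 0 ≤ s ∧ r • c ∈ s • C} := ⟨0, fun _ hs => hs.1⟩
  have hgr : gaugeAt C (r • c) ≤ r := csInf_le hbdd ⟨hr0, c, hcC, rfl⟩
  set b := r • c
  set g := gaugeAt C b
  set ε := min (lbar / 2) ((g - lbar) / 2)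
  have hε0 : 0 < ε := lt_min (by linarith) (by linarith)
  have hε1 : ε ≤ lbar / 2 := min_le_left _ _
  have hε2 : ε ≤ (g - lbar) / 2 := min_le_right _ _
  set t := lbar + ε with ht
  have ht0 : 0 < t := by linarith
  have hr : 0 < r := by linarith
  have h0mem (l : ℝ) : (0 : EuclideanSpace ℝ (Fin p)) ∈ l • C := ⟨0, h0C, smul_zero l⟩
  have hnorm (l : ℝ) (hl : 0 < l) : ‖P l‖ ≤ 2 * ‖b‖ := by
    have h1 := (hP l hl).2 0 (h0mem l)
    rw [sub_zero] at h1
    have h2 := norm_sub_le b (b - P l)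
    rw [sub_sub_cancel] at h2
    linarith
  set δ := ‖b - P t‖
  have hδ0 : 0 < δ := by
    refine norm_pos_iff.2 fun h => ?_
    have h1 : g ≤ t := csInf_le hbdd ⟨ht0.le, by rw [sub_eq_zero.1 h]; exact (hP t ht0).1⟩
    linarith
  have hb0 : 0 < ‖b‖ := hδ0.trans_le (by simpa using (hP t ht0).2 0 (h0mem t))
  have hδle (m : ℝ) (hm : 0 < m) (hmt : m ≤ t) : δ ≤ ‖b - P m‖ := by
    refine (hP t ht0).2 _ ?_
    obtain ⟨v, hv, hvm⟩ := (hP m hm).1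
    refine ⟨(m / t) • v, ?_, ?_⟩
    · exact hCconv.smul_mem_of_zero_mem h0C hv ⟨by positivity, (div_le_one ht0).2 hmt⟩
    · rw [← hvm]
      simp only [smul_smul]
      rw [mul_div_cancel₀ _ ht0.ne']
  set k := (lbar / 2) * δ ^ 2 / (r ^ 2 * (2 * ‖b‖)) with hk
  have hk0 : 0 < k := by positivity
  refine ⟨ε, hε0, k, max k (2 * ‖b‖ / (lbar / 2)), hk0, le_max_left _ _, fun l hl => ?_⟩
  refine deriv_mem_Icc_of_forall_lt hl fun m hm hlm => ?_
  have hl2 : lbar / 2 < l := by linarith [hl.1]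
  have hl0 : 0 < l := by linarith
  have hm0 : 0 < m := hl0.trans hlm
  have hmr : m ≤ r := by linarith [hm.2]
  have hd := hδle m hm0 hm.2.le
  have hxB := hnorm l hl0
  have hyB := hnorm m hm0
  obtain ⟨⟨u, hu, hxu⟩, hminx⟩ := hP l hl0
  obtain ⟨⟨v, hv, hyv⟩, hminy⟩ := hP m hm0
  replace hxu : l • u = P l := hxu
  replace hyv : m • v = P m := hyv
  rw [hψ, hψ]
  rw [← hxu] at hminx hxB ⊢
  rw [← hyv] at hminy hyB hd ⊢
  have hvx := inner_sub_smul_le_zero_of_nearest hCconv hl0 hu hminx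
  have hvy := inner_sub_smul_le_zero_of_nearest hCconv hm0 hv hminy
  have hA := mul_norm_sub_sq_le_of_variational hl0 hm0 (hvx v hv) (hvy u hu)
  have hB := mul_norm_sub_le_of_variational hl0.le hlm.le hmr (hvy u hu) (hvy c hcC)
  have hcs := real_inner_le_norm (l • u) (m • v - l • u)
  have hsq := norm_add_sq_real (l • u) (m • v - l • u)
  rw [add_sub_cancel] at hsq
  have htri := norm_sub_norm_le (m • v) (l • u)
  have hml : 0 < m - l := sub_pos.2 hlm
  generalize ⟪l • u, m • v - l • u⟫ = I at *
  have hxn := norm_nonneg (l • u)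
  have hyn := norm_nonneg (m • v)
  have hzn := norm_nonneg (m • v - l • u)
  generalize ‖l • u‖ = X at *
  generalize ‖m • v‖ = Y at *
  generalize ‖m • v - l • u‖ = Z at *
  have hZ : (m - l) * δ ≤ r * Z := by
    calc (m - l) * δ ≤ (m - l) * ‖b - m • v‖ := by gcongr
      _ ≤ (r - m) * Z := hB
      _ ≤ r * Z := by gcongr; linarith
  have hI : 0 ≤ I := by
    refine nonneg_of_mul_nonneg_right (le_trans ?_ hA) hml
    positivity
  have hXY : X ≤ Y := (sq_le_sq₀ hxn hyn).1 (by linarith [sq_nonneg Z])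
  constructor
  · have h1 : I ≤ 2 * ‖b‖ * (Y - X) := by
      have := mul_le_mul_of_nonneg_left (add_le_add hxB hyB) (sub_nonneg.2 hXY)
      linarith [sq_nonneg Z]
    have h2 : (m - l) * ((lbar / 2) * ((m - l) * δ ^ 2)) ≤ (m - l) * (r ^ 2 * I) := by
      calc (m - l) * ((lbar / 2) * ((m - l) * δ ^ 2)) = (lbar / 2) * ((m - l) * δ) ^ 2 := by ring
        _ ≤ l * (r * Z) ^ 2 := by gcongr
        _ = r ^ 2 * (l * Z ^ 2) := by ring
        _ ≤ r ^ 2 * ((m - l) * I) := by gcongr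
        _ = (m - l) * (r ^ 2 * I) := by ring
    have h3 := le_of_mul_le_mul_left h2 hml
    rw [hk, div_mul_eq_mul_div, div_le_iff₀ (by positivity)]
    linarith [mul_le_mul_of_nonneg_left h1 (sq_nonneg r)]
  · refine le_trans ?_ (mul_le_mul_of_nonneg_right (le_max_right _ _) hml.le)
    rw [div_mul_eq_mul_div, le_div_iff₀ (by positivity)]
    have h1 : Z * (l * Z) ≤ Z * ((m - l) * X) := by
      linarith [mul_le_mul_of_nonneg_left hcs hml.le]
    have h2 : l * Z ≤ (m - l) * X := by
      rcases hzn.eq_or_lt with h | h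
      · rw [← h, mul_zero]; positivity
      · exact le_of_mul_le_mul_left h1 h
    calc (Y - X) * (lbar / 2) ≤ Z * l := by gcongr
      _ = l * Z := mul_comm _ _
      _ ≤ (m - l) * X := h2
      _ ≤ (m - l) * (2 * ‖b‖) := by gcongr
      _ = 2 * ‖b‖ * (m - l) := mul_comm _ _
end

section
/- For every λ ∈ (0, Υ(b∣C)) the following three facts hold: Π_{λC}(b) ≠ 0, b − Π_{λC}(b) ≠ 0, and ⟨Π_{λC}(b), b − Π_{λC}(b)⟩ > 0. -/
open Pointwise RealInnerProductSpace

/-- The variational inequality for a nearest point `q` of a convex set `K`. -/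
theorem Convex.inner_sub_le_zero_of_forall_norm_sub_le {E : Type*} [NormedAddCommGroup E]
    [InnerProductSpace ℝ E] {K : Set E} (hK : Convex ℝ K) {b q w : E} (hq : q ∈ K)
    (hmin : ∀ w ∈ K, ‖b - q‖ ≤ ‖b - w‖) (hw : w ∈ K) : ⟪b - q, w - q⟫ ≤ 0 := by
  have : Nonempty K := ⟨⟨q, hq⟩⟩
  refine (norm_eq_iInf_iff_real_inner_le_zero hK hq).1 (le_antisymm ?_ ?_) w hw
  · exact le_ciInf fun w => hmin w w.2
  · exact ciInf_le (f := fun w : K => ‖b - w‖)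
      ⟨0, Set.forall_mem_range.2 fun _ => norm_nonneg _⟩ ⟨q, hq⟩

/-- For every `λ ∈ (0, Υ(b∣C))` one has `Π_{λC}(b) ≠ 0`, `b − Π_{λC}(b) ≠ 0`, and
`⟨Π_{λC}(b), b − Π_{λC}(b)⟩ > 0`. -/
theorem projection_nonvanishing {p : ℕ} (hp : 0 < p)
    (C : Set (EuclideanSpace ℝ (Fin p))) (b : EuclideanSpace ℝ (Fin p))
    (hCclosed : IsClosed C) (hCconv : Convex ℝ C)
    (h0C : (0 : EuclideanSpace ℝ (Fin p)) ∈ C)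
    (hfin : {r : ℝ | 0 ≤ r ∧ b ∈ r • C}.Nonempty)
    (hpos : 0 < gaugeAt C b)
    (P : ℝ → EuclideanSpace ℝ (Fin p))
    (hP : ∀ l : ℝ, 0 < l → P l ∈ l • C ∧ ∀ w ∈ l • C, ‖b - P l‖ ≤ ‖b - w‖) :
    ∀ l ∈ Set.Ioo 0 (gaugeAt C b),
      P l ≠ 0 ∧ b - P l ≠ 0 ∧ 0 < ⟪P l, b - P l⟫ := by
  rintro l ⟨hl, hlt⟩
  obtain ⟨hq, hmin⟩ := hP l hl
  have gauge_le {r : ℝ} (hr : 0 ≤ r ∧ b ∈ r • C) : gaugeAt C b ≤ r :=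
    csInf_le ⟨0, fun _ hx => hx.1⟩ hr
  have hne : b - P l ≠ 0 := fun h =>
    hlt.not_ge (gauge_le ⟨hl.le, sub_eq_zero.1 h ▸ hq⟩)
  have hvar : ∀ w ∈ l • C, ⟪b - P l, w - P l⟫ ≤ 0 := fun w hw =>
    (hCconv.smul l).inner_sub_le_zero_of_forall_norm_sub_le hq hmin hw
  suffices hinner : 0 < ⟪P l, b - P l⟫ from
    ⟨fun h => by simp [h] at hinner, hne, hinner⟩
  obtain ⟨r, hr⟩ := hfin
  have hr0 : 0 < r := hpos.trans_le (gauge_le hr)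
  have hzero := hvar 0 ⟨0, h0C, smul_zero l⟩
  have hscaled : (l / r) • b ∈ l • C := by
    obtain ⟨c, hc, hcb⟩ := hr.2
    refine ⟨c, hc, ?_⟩
    simp only [← hcb, smul_smul, div_mul_cancel₀ l hr0.ne']
  have hray := hvar _ hscaled
  have hdecomp : ⟪b - P l, b⟫ = ⟪b - P l, b - P l⟫ + ⟪b - P l, P l⟫ := by
    rw [← inner_add_right, sub_add_cancel]
  have hsq : 0 < ⟪b - P l, b - P l⟫ := real_inner_self_pos.2 hne
  rw [inner_sub_right, inner_zero_right] at hzero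
  rw [inner_sub_right, real_inner_smul_right] at hray
  rw [real_inner_comm]
  have hprod : 0 < l / r * ⟪b - P l, b⟫ := mul_pos (div_pos hl hr0) (by linarith)
  linarith
end

section
/- Let λ0 ∈ (0, Υ(b∣C)). Then for every λ with 0 < λ ≤ λ0, the lower bound (λ/λ0) · ‖Π_{λ0C}(b)‖ ≤ ‖Π_{λC}(b)‖ holds; that is, ψ(λ) ≥ (λ/λ0) ψ(λ0). -/
open Pointwise RealInnerProductSpace

/-- Variational inequality characterising a nearest point of a convex set. -/
lemma inner_sub_sub_nonpos_of_nearest {E : Type*} [NormedAddCommGroup E] [InnerProductSpace ℝ E]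
    {K : Set E} (hK : Convex ℝ K) {b x : E} (hx : x ∈ K) (hmin : ∀ w ∈ K, ‖b - x‖ ≤ ‖b - w‖)
    {w : E} (hw : w ∈ K) : ⟪b - x, w - x⟫ ≤ 0 := by
  refine (norm_eq_iInf_iff_real_inner_le_zero hK hx).1 ?_ w hw
  have : Nonempty K := ⟨⟨x, hx⟩⟩
  refine le_antisymm (le_ciInf fun w => hmin w w.2) ?_
  exact ciInf_le (f := fun w : K => ‖b - w‖)
    ⟨0, Set.forall_mem_range.2 fun w => norm_nonneg _⟩ ⟨x, hx⟩

/-- If `x` and `y` are the nearest points to `b` of the dilates `t • C` and `s • C` of a convex set,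
with `0 < t ≤ s`, then `t * ‖y‖ ≤ s * ‖x‖`. -/
lemma mul_norm_le_mul_norm_of_nearest_smul {E : Type*} [NormedAddCommGroup E]
    [InnerProductSpace ℝ E] {C : Set E} (hC : Convex ℝ C) {b x y : E} {t s : ℝ}
    (ht : 0 < t) (hts : t ≤ s)
    (hx : x ∈ t • C) (hxmin : ∀ w ∈ t • C, ‖b - x‖ ≤ ‖b - w‖)
    (hy : y ∈ s • C) (hymin : ∀ w ∈ s • C, ‖b - y‖ ≤ ‖b - w‖) :
    t * ‖y‖ ≤ s * ‖x‖ := by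
  have hs : 0 < s := ht.trans_le hts
  obtain ⟨u, hu, rfl⟩ := hx
  obtain ⟨v, hv, rfl⟩ := hy
  have hu' := inner_sub_sub_nonpos_of_nearest (hC.smul t) (Set.smul_mem_smul_set hu) hxmin
    (Set.smul_mem_smul_set hv)
  have hv' := inner_sub_sub_nonpos_of_nearest (hC.smul s) (Set.smul_mem_smul_set hv) hymin
    (Set.smul_mem_smul_set hu)
  simp only [← smul_sub, inner_smul_right] at hu' hv'
  replace hu' := nonpos_of_mul_nonpos_right hu' ht
  replace hv' := nonpos_of_mul_nonpos_right hv' hs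
  simp only [inner_sub_left, inner_sub_right, real_inner_smul_left, real_inner_self_eq_norm_sq,
    real_inner_comm u v] at hu' hv'
  have hcs := mul_le_mul_of_nonneg_left (real_inner_le_norm u v) (add_pos hs ht).le
  have hnorm : ‖v‖ ≤ ‖u‖ := by
    by_contra! h
    have hlt : t * ‖u‖ < s * ‖v‖ := mul_lt_mul' hts h (norm_nonneg u) hs
    nlinarith [mul_pos (sub_pos.2 hlt) (sub_pos.2 h)]
  simp only [norm_smul, Real.norm_of_nonneg ht.le, Real.norm_of_nonneg hs.le]
  calc t * (s * ‖v‖) ≤ t * (s * ‖u‖) := by gcongr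
    _ = s * (t * ‖u‖) := by ring

/-- Lower bound function: for `λ0 ∈ (0, Υ(b∣C))` and every `0 < λ ≤ λ0`,
`(λ/λ0)‖Π_{λ0 C}(b)‖ ≤ ‖Π_{λC}(b)‖`, i.e. `ψ(λ) ≥ (λ/λ0) ψ(λ0)`. -/
theorem psi_lower_bound {p : ℕ} (hp : 0 < p)
    (C : Set (EuclideanSpace ℝ (Fin p))) (b : EuclideanSpace ℝ (Fin p))
    (hCclosed : IsClosed C) (hCconv : Convex ℝ C)
    (h0C : (0 : EuclideanSpace ℝ (Fin p)) ∈ C)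
    (hfin : {r : ℝ | 0 ≤ r ∧ b ∈ r • C}.Nonempty)
    (hpos : 0 < gaugeAt C b)
    (P : ℝ → EuclideanSpace ℝ (Fin p))
    (hP : ∀ l : ℝ, 0 < l → P l ∈ l • C ∧ ∀ w ∈ l • C, ‖b - P l‖ ≤ ‖b - w‖)
    (ψ : ℝ → ℝ) (hψ : ∀ l, ψ l = ‖P l‖)
    (l0 : ℝ) (hl0 : l0 ∈ Set.Ioo 0 (gaugeAt C b)) :
    ∀ l : ℝ, 0 < l → l ≤ l0 → l / l0 * ‖P l0‖ ≤ ‖P l‖ ∧ l / l0 * ψ l0 ≤ ψ l := by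
  intro l hl hle
  have key : l / l0 * ‖P l0‖ ≤ ‖P l‖ := by
    rw [div_mul_eq_mul_div, div_le_iff₀' hl0.1]
    exact mul_norm_le_mul_norm_of_nearest_smul hCconv hl hle (hP l hl).1 (hP l hl).2
      (hP l0 hl0.1).1 (hP l0 hl0.1).2
  exact ⟨key, by simpa only [hψ] using key⟩
end

section
/- Let λ0 ∈ (0, Υ(b∣C)) and write y0 := Π_{λ0C}(b). Then for every λ with 0 < λ ≤ λ0, the upper bound ψ(λ)² ≤ ‖y0‖² + ((λ² − λ0²)/λ0²) · ⟨y0, b − y0⟩² / ‖b − y0‖² holds. -/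
open Pointwise RealInnerProductSpace

/-- First-order optimality of a nearest point `y` of a convex set to `b`. -/
theorem inner_sub_nonpos_of_forall_norm_sub_le {E : Type*} [NormedAddCommGroup E]
    [InnerProductSpace ℝ E] {K : Set E} (hK : Convex ℝ K) {b y : E} (hy : y ∈ K)
    (hmin : ∀ w ∈ K, ‖b - y‖ ≤ ‖b - w‖) {w : E} (hw : w ∈ K) :
    ⟪b - y, w - y⟫ ≤ 0 := by
  refine (norm_eq_iInf_iff_real_inner_le_zero hK hy).1 (le_antisymm ?_ ?_) w hw
  · have : Nonempty K := ⟨⟨y, hy⟩⟩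
    exact le_ciInf fun z => hmin z z.2
  · exact ciInf_le (f := fun z : K => ‖b - z‖)
      ⟨0, Set.forall_mem_range.2 fun _ => norm_nonneg _⟩ ⟨y, hy⟩

/-- If `y` lies in the ball with diameter `[t • z, z]` and in the half-space
`⟪u, ·⟫ ≤ t * ⟪u, z⟫`, then its norm is controlled by that of `z`. -/
theorem norm_sq_le_of_inner_sub_smul_nonpos {E : Type*} [NormedAddCommGroup E]
    [InnerProductSpace ℝ E] {u y z : E} {t : ℝ} (ht : t < 1) (ht' : 0 ≤ 1 + t) (hu : u ≠ 0)
    (hz : 0 ≤ ⟪u, z⟫) (hhalf : ⟪u, y⟫ ≤ t * ⟪u, z⟫)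
    (hball : ‖y‖ ^ 2 ≤ (1 + t) * ⟪z, y⟫ - t * ‖z‖ ^ 2) :
    ‖y‖ ^ 2 ≤ ‖z‖ ^ 2 + (t ^ 2 - 1) * (⟪u, z⟫ / ‖u‖) ^ 2 := by
  have hn : 0 < ‖u‖ := norm_pos_iff.2 hu
  have hcs : (⟪u, z⟫ / ‖u‖ - ⟪u, y⟫ / ‖u‖) ^ 2 ≤ ‖z‖ ^ 2 - 2 * ⟪z, y⟫ + ‖y‖ ^ 2 := by
    rw [← norm_sub_sq_real, ← sub_div, ← inner_sub_right, div_pow, div_le_iff₀ (by positivity),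
      ← mul_pow, mul_comm, sq_le_sq, abs_of_nonneg (a := ‖u‖ * _) (by positivity)]
    exact abs_real_inner_le_norm _ _
  have hα : 0 ≤ ⟪u, z⟫ / ‖u‖ := by positivity
  have hβ : ⟪u, y⟫ / ‖u‖ ≤ t * (⟪u, z⟫ / ‖u‖) := by
    rw [← mul_div_assoc]
    gcongr
  generalize ⟪u, z⟫ / ‖u‖ = α at *
  generalize ⟪u, y⟫ / ‖u‖ = β at *
  have hquad : (1 - t ^ 2) * (1 - t) * α ^ 2 ≤ (1 + t) * (α - β) ^ 2 := by
    have h : ((1 - t) * α) ^ 2 ≤ (α - β) ^ 2 :=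
      pow_le_pow_left₀ (mul_nonneg (by linarith) hα) (by linarith) 2
    nlinarith [mul_le_mul_of_nonneg_left h ht']
  have hsum := mul_le_mul_of_nonneg_left hcs ht'
  refine le_of_mul_le_mul_left ?_ (sub_pos.2 ht)
  linarith

/-- Upper bound function: for `λ0 ∈ (0, Υ(b∣C))`, `y0 := Π_{λ0 C}(b)` and every `0 < λ ≤ λ0`,
`ψ(λ)² ≤ ‖y0‖² + ((λ² − λ0²)/λ0²) ⟨y0, b − y0⟩² / ‖b − y0‖²`. -/
theorem psi_upper_bound {p : ℕ} (hp : 0 < p)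
    (C : Set (EuclideanSpace ℝ (Fin p))) (b : EuclideanSpace ℝ (Fin p))
    (hCclosed : IsClosed C) (hCconv : Convex ℝ C)
    (h0C : (0 : EuclideanSpace ℝ (Fin p)) ∈ C)
    (hfin : {r : ℝ | 0 ≤ r ∧ b ∈ r • C}.Nonempty)
    (hpos : 0 < gaugeAt C b)
    (P : ℝ → EuclideanSpace ℝ (Fin p))
    (hP : ∀ l : ℝ, 0 < l → P l ∈ l • C ∧ ∀ w ∈ l • C, ‖b - P l‖ ≤ ‖b - w‖)
    (ψ : ℝ → ℝ) (hψ : ∀ l, ψ l = ‖P l‖)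
    (l0 : ℝ) (hl0 : l0 ∈ Set.Ioo 0 (gaugeAt C b)) :
    ∀ l : ℝ, 0 < l → l ≤ l0 →
      ψ l ^ 2 ≤ ‖P l0‖ ^ 2 +
        (l ^ 2 - l0 ^ 2) / l0 ^ 2 * ⟪P l0, b - P l0⟫ ^ 2 / ‖b - P l0‖ ^ 2 := by
  intro l hl hle
  obtain ⟨h0pos, h0lt⟩ := hl0
  rw [hψ]
  rcases hle.eq_or_lt with rfl | hlt
  · simp
  obtain ⟨hm0, hmin0⟩ := hP l0 h0pos
  obtain ⟨hm, hmin⟩ := hP l hl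
  have hu : b - P l0 ≠ 0 := fun h => by
    rw [← sub_eq_zero.1 h] at hm0
    exact h0lt.not_ge (csInf_le ⟨0, fun r hr => hr.1⟩ ⟨h0pos.le, hm0⟩)
  have var0 : ∀ w ∈ l0 • C, ⟪b - P l0, w - P l0⟫ ≤ 0 := fun w =>
    inner_sub_nonpos_of_forall_norm_sub_le (hCconv.smul l0) hm0 hmin0
  have hz := var0 0 ⟨0, h0C, smul_zero _⟩
  obtain ⟨c, hc, hcy⟩ := id hm
  obtain ⟨c0, hc0, hcy0⟩ := id hm0
  simp only at hcy hcy0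
  have hy := var0 ((l0 / l) • P l) ⟨c, hc, by
    simp only [← hcy, smul_smul, div_mul_cancel₀ _ hl.ne']⟩
  have hb := inner_sub_nonpos_of_forall_norm_sub_le (hCconv.smul l) hm hmin
    (w := (l / l0) • P l0) ⟨c0, hc0, by
      simp only [← hcy0, smul_smul, div_mul_cancel₀ _ h0pos.ne']⟩
  have ht : l / l0 < 1 := (div_lt_one h0pos).2 hlt
  have ht0 : 0 < l / l0 := by positivity
  rw [zero_sub, inner_neg_right] at hz
  have hhalf : ⟪b - P l0, P l⟫ ≤ l / l0 * ⟪b - P l0, P l0⟫ := by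
    rw [inner_sub_right, real_inner_smul_right, sub_nonpos] at hy
    have h := mul_le_mul_of_nonneg_left hy ht0.le
    rwa [← mul_assoc, div_mul_div_cancel₀ h0pos.ne', div_self hl.ne', one_mul] at h
  have hball : ‖P l‖ ^ 2 ≤ (1 + l / l0) * ⟪P l0, P l⟫ - l / l0 * ‖P l0‖ ^ 2 := by
    have h := hhalf
    simp only [inner_sub_left, inner_sub_right, real_inner_smul_right,
      real_inner_self_eq_norm_sq] at hb h
    rw [real_inner_comm (P l0) (P l)] at hb
    linarith
  have key := norm_sq_le_of_inner_sub_smul_nonpos ht (by linarith) hu (by linarith) hhalf hball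
  convert key using 2
  rw [real_inner_comm, mul_div_assoc, ← div_pow, sub_div, div_self (by positivity), div_pow l]
end

section
/- Let E and F be real inner product spaces, let g : E → ℝ be a convex function, let A : E → F be a linear map, and let b ∈ F. If X1 and X2 are both minimizers of the function h(X) := g(X) + (1/2)‖A X − b‖² over E, then A X1 = A X2; in particular ‖A X1 − b‖ = ‖A X2 − b‖, so the residual value ‖A X(λ) − b‖ is independent of the particular choice of optimal solution. -/
open RealInnerProductSpace

/-- If `X1` and `X2` both minimize `h(X) = g(X) + (1/2)‖A X − b‖²` with `g` convex and
`A` linear, then `A X1 = A X2`; in particular the residual `‖A X − b‖` is the same for all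
optimal solutions. -/
theorem residual_independent_of_solution
    {E F : Type*} [NormedAddCommGroup E] [InnerProductSpace ℝ E]
    [NormedAddCommGroup F] [InnerProductSpace ℝ F]
    (g : E → ℝ) (hg : ConvexOn ℝ Set.univ g)
    (A : E →ₗ[ℝ] F) (b : F) (X1 X2 : E)
    (h1 : ∀ X : E, g X1 + 1 / 2 * ‖A X1 - b‖ ^ 2 ≤ g X + 1 / 2 * ‖A X - b‖ ^ 2)
    (h2 : ∀ X : E, g X2 + 1 / 2 * ‖A X2 - b‖ ^ 2 ≤ g X + 1 / 2 * ‖A X - b‖ ^ 2) :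
    A X1 = A X2 ∧ ‖A X1 - b‖ = ‖A X2 - b‖ := by
  have hA : A X1 = A X2 := by
    have hconv := hg.2 (Set.mem_univ X1) (Set.mem_univ X2)
      (by norm_num : (0 : ℝ) ≤ 1 / 2) (by norm_num : (0 : ℝ) ≤ 1 / 2) (by norm_num)
    simp only [smul_eq_mul] at hconv
    have hmid : A ((1 / 2 : ℝ) • X1 + (1 / 2 : ℝ) • X2) - b
        = (1 / 2 : ℝ) • ((A X1 - b) + (A X2 - b)) := by
      rw [map_add, map_smul, map_smul]
      module
    have hnorm : ‖A ((1 / 2 : ℝ) • X1 + (1 / 2 : ℝ) • X2) - b‖ ^ 2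
        = 1 / 4 * ‖(A X1 - b) + (A X2 - b)‖ ^ 2 := by
      rw [hmid, norm_smul, mul_pow]
      norm_num
    have hpar := parallelogram_law_with_norm ℝ (A X1 - b) (A X2 - b)
    rw [sub_sub_sub_cancel_right] at hpar
    have hle1 := h1 ((1 / 2 : ℝ) • X1 + (1 / 2 : ℝ) • X2)
    have hle2 := h2 ((1 / 2 : ℝ) • X1 + (1 / 2 : ℝ) • X2)
    have hsq : ‖A X1 - A X2‖ ^ 2 = 0 :=
      le_antisymm (by nlinarith) (sq_nonneg _)
    exact sub_eq_zero.mp (norm_eq_zero.mp (pow_eq_zero_iff two_ne_zero |>.mp hsq))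
  exact ⟨hA, by rw [hA]⟩
end

section
/- Let b, y0, z ∈ ℝ^p with b ≠ y0 and ⟨y0, b − y0⟩ ≥ 0, and let λ0 > 0, λ > 0, β > 0 be real numbers with λ ≤ β λ0. If ⟨z − (λ/λ0) y0, b − y0⟩ ≤ 0 and ⟨z − (λ/λ0) y0, z − β y0⟩ = 0, then ‖z‖² ≤ β²‖y0‖² + ((λ² − β²λ0²)/λ0²) · ⟨y0, b − y0⟩² / ‖b − y0‖². -/
open RealInnerProductSpace

/-- If `w` makes an obtuse angle with `d` and lies on the sphere with diameter `[0, k • y]`, then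
`⟪w, y⟫` is at most `k` times the squared norm of the component of `y` orthogonal to `d`. -/
lemma inner_le_of_inner_nonpos_of_norm_sq_eq {E : Type*} [NormedAddCommGroup E]
    [InnerProductSpace ℝ E] {w y d : E} {k : ℝ} (hd : d ≠ 0) (hk : 0 ≤ k)
    (hyd : 0 ≤ ⟪y, d⟫) (hwd : ⟪w, d⟫ ≤ 0) (hw : ‖w‖ ^ 2 = k * ⟪w, y⟫) :
    ⟪w, y⟫ ≤ k * (‖y‖ ^ 2 - ⟪y, d⟫ ^ 2 / ‖d‖ ^ 2) := by
  rcases hk.eq_or_lt with rfl | hk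
  · have : w = 0 := by simpa using hw
    simp [this]
  have hD : 0 < ‖d‖ ^ 2 := by positivity
  obtain ⟨r, hr⟩ : ∃ r, r = ⟪y, d⟫ / ‖d‖ ^ 2 := ⟨_, rfl⟩
  have hrD : r * ‖d‖ ^ 2 = ⟪y, d⟫ := by rw [hr]; field_simp
  have hr0 : 0 ≤ r := by rw [hr]; positivity
  have hsq : ⟪y, d⟫ ^ 2 / ‖d‖ ^ 2 = r * ⟪y, d⟫ := by rw [hr]; ring
  have hnorm : ‖y - r • d‖ ^ 2 = ‖y‖ ^ 2 - r * ⟪y, d⟫ := by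
    rw [norm_sub_sq_real, inner_smul_right, norm_smul, mul_pow, Real.norm_eq_abs, sq_abs]
    linear_combination r * hrD
  have hinner : ⟪w, y⟫ ≤ ⟪w, y - r • d⟫ := by
    rw [inner_sub_right, inner_smul_right]
    nlinarith
  have hpos : 0 ≤ ‖w - k • (y - r • d)‖ ^ 2 := sq_nonneg _
  rw [norm_sub_sq_real, inner_smul_right, norm_smul, mul_pow, Real.norm_eq_abs, sq_abs, hw,
    hnorm] at hpos
  rw [hsq]
  refine le_of_mul_le_mul_left ?_ hk
  linarith [mul_le_mul_of_nonneg_left hinner hk.le]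

/-- Optimality bound for the parametrized maximization program `ν(β)`: if
`⟨z − (λ/λ0) y0, b − y0⟩ ≤ 0` and `⟨z − (λ/λ0) y0, z − β y0⟩ = 0` with `b ≠ y0`,
`⟨y0, b − y0⟩ ≥ 0`, `λ0, λ, β > 0` and `λ ≤ β λ0`, then
`‖z‖² ≤ β²‖y0‖² + ((λ² − β²λ0²)/λ0²) ⟨y0, b − y0⟩² / ‖b − y0‖²`. -/
theorem nu_beta_bound {p : ℕ} (b y0 z : EuclideanSpace ℝ (Fin p))
    (hby0 : b ≠ y0) (hy0 : 0 ≤ ⟪y0, b - y0⟫)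
    (l0 l β : ℝ) (hl0 : 0 < l0) (hl : 0 < l) (hβ : 0 < β) (hlβ : l ≤ β * l0)
    (h1 : ⟪z - (l / l0) • y0, b - y0⟫ ≤ 0)
    (h2 : ⟪z - (l / l0) • y0, z - β • y0⟫ = 0) :
    ‖z‖ ^ 2 ≤ β ^ 2 * ‖y0‖ ^ 2 +
      (l ^ 2 - β ^ 2 * l0 ^ 2) / l0 ^ 2 * ⟪y0, b - y0⟫ ^ 2 / ‖b - y0‖ ^ 2 := by
  obtain ⟨t, ht⟩ : ∃ t, t = l / l0 := ⟨_, rfl⟩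
  have ht0 : 0 < t := by rw [ht]; positivity
  have htβ : t ≤ β := by rwa [ht, div_le_iff₀ hl0]
  have hcoef : (l ^ 2 - β ^ 2 * l0 ^ 2) / l0 ^ 2 = t ^ 2 - β ^ 2 := by rw [ht]; field_simp
  rw [← ht] at h1 h2
  have hw : ‖z - t • y0‖ ^ 2 = (β - t) * ⟪z - t • y0, y0⟫ := by
    have : z - β • y0 = (z - t • y0) - (β - t) • y0 := by module
    rw [this, inner_sub_right, inner_smul_right, real_inner_self_eq_norm_sq] at h2
    linarith
  have key := inner_le_of_inner_nonpos_of_norm_sq_eq (sub_ne_zero.mpr hby0)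
    (sub_nonneg.mpr htβ) hy0 h1 hw
  have hz : ‖z‖ ^ 2 = (β + t) * ⟪z - t • y0, y0⟫ + t ^ 2 * ‖y0‖ ^ 2 := by
    have : z = (z - t • y0) + t • y0 := by module
    rw [this, norm_add_sq_real, add_sub_cancel_right, hw, inner_smul_right, norm_smul, mul_pow,
      Real.norm_eq_abs, sq_abs]
    ring
  rw [hz, hcoef, mul_div_assoc]
  linarith [mul_le_mul_of_nonneg_left key (add_pos hβ ht0).le]
end

section
/- Let b, y0, z ∈ ℝ^p with b ≠ y0 and ⟨y0, b − y0⟩ ≥ 0, and let λ0, λ be real numbers with 0 < λ ≤ λ0. If ⟨z − (λ/λ0) y0, b − y0⟩ ≤ 0 and ⟨z − (λ/λ0) y0, z − y0⟩ ≤ 0, then ‖z‖² ≤ ‖y0‖² + ((λ² − λ0²)/λ0²) · ⟨y0, b − y0⟩² / ‖b − y0‖². -/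
open RealInnerProductSpace

/-- Optimal value bound for the relaxed maximization program: if
`⟨z − (λ/λ0) y0, b − y0⟩ ≤ 0` and `⟨z − (λ/λ0) y0, z − y0⟩ ≤ 0` with `b ≠ y0`,
`⟨y0, b − y0⟩ ≥ 0` and `0 < λ ≤ λ0`, then
`‖z‖² ≤ ‖y0‖² + ((λ² − λ0²)/λ0²) ⟨y0, b − y0⟩² / ‖b − y0‖²`. -/
theorem relaxed_max_bound {p : ℕ} (b y0 z : EuclideanSpace ℝ (Fin p))
    (hby0 : b ≠ y0) (hy0 : 0 ≤ ⟪y0, b - y0⟫)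
    (l0 l : ℝ) (hl : 0 < l) (hll0 : l ≤ l0)
    (h1 : ⟪z - (l / l0) • y0, b - y0⟫ ≤ 0)
    (h2 : ⟪z - (l / l0) • y0, z - y0⟫ ≤ 0) :
    ‖z‖ ^ 2 ≤ ‖y0‖ ^ 2 +
      (l ^ 2 - l0 ^ 2) / l0 ^ 2 * ⟪y0, b - y0⟫ ^ 2 / ‖b - y0‖ ^ 2 := by
  have hl0 : 0 < l0 := hl.trans_le hll0
  have hN : 0 < ‖b - y0‖ ^ 2 := by
    have := norm_pos_iff.mpr (sub_ne_zero.mpr hby0)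
    positivity
  obtain ⟨t, ht⟩ : ∃ t, t = l / l0 := ⟨_, rfl⟩
  have ht0 : 0 < t := ht ▸ div_pos hl hl0
  have ht1 : t ≤ 1 := ht ▸ (div_le_one hl0).mpr hll0
  have hcoef : (l ^ 2 - l0 ^ 2) / l0 ^ 2 = t ^ 2 - 1 := by
    rw [ht]; field_simp
  rw [← ht] at h1 h2
  rw [hcoef]
  rcases ht1.eq_or_lt with rfl | hlt
  · rw [one_smul, real_inner_self_nonpos, sub_eq_zero] at h2
    simp [h2]
  have hCS := real_inner_mul_inner_self_le (z - y0) (b - y0)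
  rw [real_inner_self_eq_norm_sq (b - y0)] at hCS
  generalize b - y0 = u at *
  simp only [inner_sub_left, inner_sub_right, real_inner_smul_left,
    real_inner_self_eq_norm_sq, real_inner_comm z y0] at h1 h2 hCS
  generalize ‖u‖ ^ 2 = N at *
  generalize ⟪y0, u⟫ = c at *
  generalize ⟪z, u⟫ = d at *
  generalize ‖z‖ ^ 2 = Z at *
  generalize ‖y0‖ ^ 2 = Y at *
  generalize ⟪z, y0⟫ = P at *
  have hdc : d ≤ c := by nlinarith
  have hprod : 0 ≤ (c - d) * (t * c - d) := mul_nonneg (by linarith) (by linarith)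
  have hP : N * (P - Y) ≤ (d - c) * c := by
    refine le_of_mul_le_mul_left ?_ (sub_pos.mpr hlt)
    nlinarith [mul_le_mul_of_nonneg_left h2 hN.le]
  rw [← sub_le_iff_le_add', le_div_iff₀ hN]
  nlinarith [mul_le_mul_of_nonneg_left h2 hN.le,
    mul_le_mul_of_nonneg_left hP (by linarith : (0 : ℝ) ≤ 1 + t),
    mul_nonneg (mul_nonneg (by linarith : (0 : ℝ) ≤ 1 + t) hy0) (by linarith : 0 ≤ t * c - d)]
end

section
/- Let b, y0, z ∈ ℝ^p and let λ0, λ be real numbers with 0 < λ ≤ λ0. Assume ⟨y0, b − y0⟩ ≥ 0, ⟨z − (λ/λ0) y0, b − y0⟩ ≤ 0, ⟨z − (λ/λ0) y0, z − b⟩ ≤ 0, and ⟨z, z − b⟩ ≤ 0. Define S := conv{0, λ0⁻¹ y0, λ⁻¹ z} (the convex hull). Then y0 ∈ λ0 • S and ‖b − y0‖ ≤ ‖b − w‖ for every w ∈ λ0 • S, and z ∈ λ • S and ‖b − z‖ ≤ ‖b − w‖ for every w ∈ λ • S; that is, y0 is the projection of b onto λ0 • S and z is the projection of b onto λ • S.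 -/
open Pointwise RealInnerProductSpace

/-- If `b - y` makes a nonacute angle with `v - y` for every `v ∈ s`, then no point of the convex
hull of `s` is closer to `b` than `y`. -/
theorem norm_sub_le_of_mem_convexHull {E : Type*} [NormedAddCommGroup E] [InnerProductSpace ℝ E]
    {s : Set E} {b y w : E} (h : ∀ v ∈ s, ⟪b - y, v - y⟫ ≤ 0) (hw : w ∈ convexHull ℝ s) :
    ‖b - y‖ ≤ ‖b - w‖ := by
  have hconv : Convex ℝ {v : E | ⟪b - y, v⟫ ≤ ⟪b - y, y⟫} :=
    convex_halfSpace_le (innerₛₗ ℝ (b - y)).isLinear _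
  have hmem : ⟪b - y, w⟫ ≤ ⟪b - y, y⟫ := by
    refine convexHull_min (fun v hv => ?_) hconv hw
    simpa [inner_sub_right] using h v hv
  have hexp : ‖b - w‖ ^ 2 = ‖b - y‖ ^ 2 - 2 * ⟪b - y, w - y⟫ + ‖w - y‖ ^ 2 := by
    rw [← norm_sub_sq_real, sub_sub_sub_cancel_right]
  rw [inner_sub_right] at hexp
  refine (sq_le_sq₀ (norm_nonneg _) (norm_nonneg _)).1 ?_
  nlinarith [sq_nonneg ‖w - y‖]

/-- If `z` satisfies the three inner-product inequalities of the explicit program, then with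
`S := conv{0, λ0⁻¹ y0, λ⁻¹ z}`, the point `y0` is the projection of `b` onto `λ0 • S` and `z`
is the projection of `b` onto `λ • S`. -/
theorem feasible_for_set_program {p : ℕ} (b y0 z : EuclideanSpace ℝ (Fin p))
    (l0 l : ℝ) (hl : 0 < l) (hll0 : l ≤ l0)
    (hy0 : 0 ≤ ⟪y0, b - y0⟫)
    (h1 : ⟪z - (l / l0) • y0, b - y0⟫ ≤ 0)
    (h2 : ⟪z - (l / l0) • y0, z - b⟫ ≤ 0)
    (h3 : ⟪z, z - b⟫ ≤ 0) :
    let S : Set (EuclideanSpace ℝ (Fin p)) :=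
      convexHull ℝ {0, l0⁻¹ • y0, l⁻¹ • z}
    y0 ∈ l0 • S ∧ (∀ w ∈ l0 • S, ‖b - y0‖ ≤ ‖b - w‖) ∧
    z ∈ l • S ∧ (∀ w ∈ l • S, ‖b - z‖ ≤ ‖b - w‖) := by
  intro S
  have hl0 : 0 < l0 := hl.trans_le hll0
  have hS (c : ℝ) : c • S = convexHull ℝ {0, c • l0⁻¹ • y0, c • l⁻¹ • z} := by
    simp only [S, ← convexHull_smul, Set.smul_set_insert, Set.smul_set_singleton, smul_zero]
  have hS0 : l0 • S = convexHull ℝ {0, y0, (l0 / l) • z} := by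
    rw [hS, smul_inv_smul₀ hl0.ne', smul_smul, div_eq_mul_inv]
  have hS1 : l • S = convexHull ℝ {0, (l / l0) • y0, z} := by
    rw [hS, smul_inv_smul₀ hl.ne', smul_smul, div_eq_mul_inv]
  rw [hS0, hS1]
  refine ⟨subset_convexHull ℝ _ (by simp), fun w => norm_sub_le_of_mem_convexHull ?_,
    subset_convexHull ℝ _ (by simp), fun w => norm_sub_le_of_mem_convexHull ?_⟩
  · rintro v (rfl | rfl | rfl)
    · rwa [zero_sub, inner_neg_right, neg_nonpos, real_inner_comm]
    · simp
    · have hv : (l0 / l) • z - y0 = (l0 / l) • (z - (l / l0) • y0) := by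
        rw [smul_sub, smul_smul, div_mul_div_cancel₀ hl.ne', div_self hl0.ne', one_smul]
      rw [hv, inner_smul_right, real_inner_comm]
      exact mul_nonpos_of_nonneg_of_nonpos (by positivity) h1
  · rintro v (rfl | rfl | rfl)
    · rwa [zero_sub, inner_neg_right, ← inner_neg_left, neg_sub, real_inner_comm]
    · rwa [← neg_sub z b, ← neg_sub z, inner_neg_neg, real_inner_comm]
    · simp
end

section
/- Let S ⊆ ℝ^p be a convex set with 0 ∈ S, let b ∈ ℝ^p, and let λ0 > 0 and λ > 0. Suppose y0 ∈ λ0 • S satisfies ‖b − y0‖ ≤ ‖b − w‖ for all w ∈ λ0 • S, and z ∈ λ • S satisfies ‖b − z‖ ≤ ‖b − w‖ for all w ∈ λ • S. Then the three inequalities ⟨z − (λ/λ0) y0, b − y0⟩ ≤ 0, ⟨z − (λ/λ0) y0, z − b⟩ ≤ 0, and ⟨z, z − b⟩ ≤ 0 hold. -/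
open Pointwise RealInnerProductSpace

/-- A nearest point of a convex set makes an obtuse angle with every point of the set. -/
theorem Convex.inner_sub_sub_nonpos_of_forall_norm_sub_le {F : Type*} [NormedAddCommGroup F]
    [InnerProductSpace ℝ F] {K : Set F} (hK : Convex ℝ K) {u v : F} (hv : v ∈ K)
    (hmin : ∀ w ∈ K, ‖u - v‖ ≤ ‖u - w‖) {w : F} (hw : w ∈ K) :
    inner ℝ (u - v) (w - v) ≤ 0 := by
  have : Nonempty K := ⟨⟨v, hv⟩⟩
  refine (norm_eq_iInf_iff_real_inner_le_zero hK hv).1 (le_antisymm ?_ ?_) w hw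
  · exact le_ciInf fun w => hmin w w.2
  · exact ciInf_le ⟨0, Set.forall_mem_range.2 fun _ => norm_nonneg _⟩ (⟨v, hv⟩ : K)

/-- Rescaling a point of `a • S` by `c / a` lands in `c • S`. -/
theorem Set.div_smul_mem_smul_set {𝕜 E : Type*} [Field 𝕜] [AddCommGroup E] [Module 𝕜 E]
    {S : Set E} {a : 𝕜} (ha : a ≠ 0) (c : 𝕜) {x : E} (hx : x ∈ a • S) :
    (c / a) • x ∈ c • S := by
  obtain ⟨s, hs, rfl⟩ := hx
  exact ⟨s, hs, by simp [smul_smul, ha]⟩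

/-- If `y0` is a nearest point of `λ0 • S` to `b` and `z` is a nearest point of `λ • S` to `b`,
where `S` is convex with `0 ∈ S`, then the three inner-product inequalities
`⟨z − (λ/λ0) y0, b − y0⟩ ≤ 0`, `⟨z − (λ/λ0) y0, z − b⟩ ≤ 0` and `⟨z, z − b⟩ ≤ 0` hold. -/
theorem projections_satisfy_inequalities {p : ℕ}
    (S : Set (EuclideanSpace ℝ (Fin p))) (hSconv : Convex ℝ S)
    (h0S : (0 : EuclideanSpace ℝ (Fin p)) ∈ S)
    (b y0 z : EuclideanSpace ℝ (Fin p))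
    (l0 l : ℝ) (hl0 : 0 < l0) (hl : 0 < l)
    (hy0 : y0 ∈ l0 • S) (hy0min : ∀ w ∈ l0 • S, ‖b - y0‖ ≤ ‖b - w‖)
    (hz : z ∈ l • S) (hzmin : ∀ w ∈ l • S, ‖b - z‖ ≤ ‖b - w‖) :
    ⟪z - (l / l0) • y0, b - y0⟫ ≤ 0 ∧
    ⟪z - (l / l0) • y0, z - b⟫ ≤ 0 ∧
    ⟪z, z - b⟫ ≤ 0 := by
  have hzero : (0 : EuclideanSpace ℝ (Fin p)) ∈ l • S := ⟨0, h0S, smul_zero l⟩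
  have h₁ := (hSconv.smul l0).inner_sub_sub_nonpos_of_forall_norm_sub_le hy0 hy0min
    (Set.div_smul_mem_smul_set hl.ne' l0 hz)
  have h₂ := (hSconv.smul l).inner_sub_sub_nonpos_of_forall_norm_sub_le hz hzmin
    (Set.div_smul_mem_smul_set hl0.ne' l hy0)
  have h₃ := (hSconv.smul l).inner_sub_sub_nonpos_of_forall_norm_sub_le hz hzmin hzero
  refine ⟨?_, ?_, ?_⟩
  · have hscale : z - (l / l0) • y0 = (l / l0) • ((l0 / l) • z - y0) := by
      rw [smul_sub, smul_smul, div_mul_div_cancel₀ hl0.ne', div_self hl.ne', one_smul]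
    rw [hscale, real_inner_smul_left, real_inner_comm]
    exact mul_nonpos_of_nonneg_of_nonpos (by positivity) h₁
  · rwa [real_inner_comm, ← inner_neg_neg, neg_sub, neg_sub]
  · rwa [real_inner_comm, ← inner_neg_neg, neg_sub, ← zero_sub z]
end

section
/- Let y0, z ∈ ℝ^p and let t be a real number with 0 ≤ t ≤ 1. If ⟨z − t y0, z − y0⟩ ≤ 0, then t ‖y0‖ ≤ ‖z‖ ≤ ‖y0‖. -/
open RealInnerProductSpace

/-- If `⟨z − t y0, z − y0⟩ ≤ 0` with `0 ≤ t ≤ 1`, then `t ‖y0‖ ≤ ‖z‖ ≤ ‖y0‖`. -/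
theorem norm_sandwich {p : ℕ} (y0 z : EuclideanSpace ℝ (Fin p))
    (t : ℝ) (ht0 : 0 ≤ t) (ht1 : t ≤ 1)
    (h : ⟪z - t • y0, z - y0⟫ ≤ 0) :
    t * ‖y0‖ ≤ ‖z‖ ∧ ‖z‖ ≤ ‖y0‖ := by
  have expand : ⟪z - t • y0, z - y0⟫ = ‖z‖ ^ 2 - (1 + t) * ⟪z, y0⟫ + t * ‖y0‖ ^ 2 := by
    simp only [inner_sub_left, inner_sub_right, real_inner_smul_left,
      real_inner_self_eq_norm_sq, real_inner_comm z y0]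
    ring
  have cauchy_schwarz : (1 + t) * ⟪z, y0⟫ ≤ (1 + t) * (‖z‖ * ‖y0‖) :=
    mul_le_mul_of_nonneg_left (real_inner_le_norm z y0) (by linarith)
  have key : (‖z‖ - t * ‖y0‖) * (‖z‖ - ‖y0‖) ≤ 0 := by
    rw [expand] at h
    linarith
  have hle : t * ‖y0‖ ≤ ‖y0‖ := mul_le_of_le_one_left (norm_nonneg y0) ht1
  constructor
  · by_contra! hlt
    exact key.not_gt (mul_pos_of_neg_of_neg (by linarith) (by linarith))
  · by_contra! hlt
    exact key.not_gt (mul_pos (by linarith) (by linarith))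
end

section
/- Let C ⊆ ℝ^p be a nonempty closed convex set with 0 ∈ C, let b ∈ ℝ^p, and for λ > 0 let P(λ) denote the unique point of λ • C nearest to b. Then for all real numbers 0 < a ≤ a' there exists a constant K ≥ 0 such that ‖P(λ1) − P(λ2)‖ ≤ K |λ1 − λ2| for all λ1, λ2 ∈ [a, a']; consequently, ψ(λ) := ‖P(λ)‖ is Lipschitz continuous on every compact subinterval of (0, +∞). -/
open Pointwise RealInnerProductSpace

/-- A nearest point of a convex set satisfies the variational inequality of the projection. -/
lemma inner_sub_le_zero_of_nearest {E : Type*} [NormedAddCommGroup E] [InnerProductSpace ℝ E]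
    {S : Set E} (hS : Convex ℝ S) {b x : E} (hx : x ∈ S) (hmin : ∀ w ∈ S, ‖b - x‖ ≤ ‖b - w‖)
    {w : E} (hw : w ∈ S) : ⟪b - x, w - x⟫ ≤ 0 := by
  have : Nonempty S := ⟨⟨x, hx⟩⟩
  refine (norm_eq_iInf_iff_real_inner_le_zero hS hx).1 (le_antisymm ?_ ?_) w hw
  · exact le_ciInf fun w => hmin w w.2
  · exact ciInf_le ⟨0, by rintro _ ⟨w, rfl⟩; exact norm_nonneg _⟩ (⟨x, hx⟩ : S)

/-- A nearest point of a set containing the origin has norm at most `2 * ‖b‖`. -/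
lemma norm_le_two_mul_of_nearest {E : Type*} [SeminormedAddCommGroup E]
    {S : Set E} (h0 : 0 ∈ S) {b x : E} (hmin : ∀ w ∈ S, ‖b - x‖ ≤ ‖b - w‖) :
    ‖x‖ ≤ 2 * ‖b‖ := by
  have h := hmin 0 h0
  rw [sub_zero] at h
  have := norm_le_norm_add_norm_sub b x
  linarith

/-- Nearest points `s • c` and `t • d` of two dilates `s • C` and `t • C` of a convex set are at
distance at most `|s - t| * ‖d‖`. -/
lemma norm_smul_sub_smul_le_of_nearest {E : Type*} [NormedAddCommGroup E] [InnerProductSpace ℝ E]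
    {C : Set E} (hC : Convex ℝ C) {b c d : E} (hc : c ∈ C) (hd : d ∈ C) {s t : ℝ}
    (hs : 0 < s) (ht : 0 < t) (hcmin : ∀ w ∈ s • C, ‖b - s • c‖ ≤ ‖b - w‖)
    (hdmin : ∀ w ∈ t • C, ‖b - t • d‖ ≤ ‖b - w‖) :
    ‖s • c - t • d‖ ≤ |s - t| * ‖d‖ := by
  have h1 := inner_sub_le_zero_of_nearest (hC.smul s) (Set.smul_mem_smul_set hc) hcmin
    (Set.smul_mem_smul_set hd)
  have h2 := inner_sub_le_zero_of_nearest (hC.smul t) (Set.smul_mem_smul_set hd) hdmin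
    (Set.smul_mem_smul_set hc)
  rw [← smul_sub, real_inner_smul_right] at h1 h2
  replace h1 := nonpos_of_mul_nonpos_right h1 hs
  replace h2 := nonpos_of_mul_nonpos_right h2 ht
  have hmono : ⟪s • c - t • d, c - d⟫ ≤ 0 := by
    have : ⟪s • c - t • d, c - d⟫ = ⟪b - s • c, d - c⟫ + ⟪b - t • d, c - d⟫ := by
      rw [← neg_sub c d, inner_neg_right, ← sub_eq_neg_add, ← inner_sub_left]
      congr 1
      abel
    linarith
  set x := s • c - t • d with hx
  have hdecomp : x = s • (c - d) + (s - t) • d := by rw [hx]; module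
  have hsq : ‖x‖ * ‖x‖ ≤ ‖x‖ * (|s - t| * ‖d‖) :=
    calc ‖x‖ * ‖x‖ = s * ⟪x, c - d⟫ + ⟪x, (s - t) • d⟫ := by
          rw [← real_inner_self_eq_norm_mul_norm, ← real_inner_smul_right, ← inner_add_right,
            ← hdecomp]
      _ ≤ ⟪x, (s - t) • d⟫ := by linarith [mul_nonpos_of_nonneg_of_nonpos hs.le hmono]
      _ ≤ ‖x‖ * ‖(s - t) • d‖ := real_inner_le_norm _ _
      _ = ‖x‖ * (|s - t| * ‖d‖) := by rw [norm_smul, Real.norm_eq_abs]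
  rcases (norm_nonneg x).eq_or_lt with h | h
  · rw [← h]
    positivity
  · exact le_of_mul_le_mul_left hsq h

/-- The map `λ ↦ Π_{λC}(b)` is Lipschitz on every compact subinterval `[a, a'] ⊂ (0, ∞)`;
consequently `ψ(λ) = ‖Π_{λC}(b)‖` is Lipschitz continuous on every such interval. -/
theorem projection_locally_lipschitz {p : ℕ}
    (C : Set (EuclideanSpace ℝ (Fin p))) (b : EuclideanSpace ℝ (Fin p))
    (hCne : C.Nonempty) (hCclosed : IsClosed C) (hCconv : Convex ℝ C)
    (h0C : (0 : EuclideanSpace ℝ (Fin p)) ∈ C)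
    (P : ℝ → EuclideanSpace ℝ (Fin p))
    (hP : ∀ l : ℝ, 0 < l → P l ∈ l • C ∧ ∀ w ∈ l • C, ‖b - P l‖ ≤ ‖b - w‖) :
    ∀ a a' : ℝ, 0 < a → a ≤ a' → ∃ K : ℝ, 0 ≤ K ∧
      (∀ l1 ∈ Set.Icc a a', ∀ l2 ∈ Set.Icc a a',
        ‖P l1 - P l2‖ ≤ K * |l1 - l2|) ∧
      (∀ l1 ∈ Set.Icc a a', ∀ l2 ∈ Set.Icc a a',
        |‖P l1‖ - ‖P l2‖| ≤ K * |l1 - l2|) := by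
  intro a a' ha _
  have hlip : ∀ l1 ∈ Set.Icc a a', ∀ l2 ∈ Set.Icc a a',
      ‖P l1 - P l2‖ ≤ 2 * ‖b‖ / a * |l1 - l2| := by
    intro s hs t ht
    have hs0 : 0 < s := ha.trans_le hs.1
    have ht0 : 0 < t := ha.trans_le ht.1
    obtain ⟨⟨c, hc, hcP : s • c = P s⟩, hcmin⟩ := hP s hs0
    obtain ⟨⟨d, hd, hdP : t • d = P t⟩, hdmin⟩ := hP t ht0
    rw [← hcP] at hcmin ⊢
    rw [← hdP] at hdmin ⊢
    have hbound : ‖d‖ ≤ 2 * ‖b‖ / a := by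
      have h0 : (0 : EuclideanSpace ℝ (Fin p)) ∈ t • C := ⟨0, h0C, smul_zero t⟩
      have h := norm_le_two_mul_of_nearest h0 hdmin
      rw [norm_smul, Real.norm_of_nonneg ht0.le] at h
      rw [le_div_iff₀ ha, mul_comm]
      exact (mul_le_mul_of_nonneg_right ht.1 (norm_nonneg d)).trans h
    calc ‖s • c - t • d‖ ≤ |s - t| * ‖d‖ :=
          norm_smul_sub_smul_le_of_nearest hCconv hc hd hs0 ht0 hcmin hdmin
      _ ≤ |s - t| * (2 * ‖b‖ / a) := by gcongr
      _ = 2 * ‖b‖ / a * |s - t| := mul_comm _ _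
  exact ⟨2 * ‖b‖ / a, by positivity, hlip, fun s hs t ht =>
    (abs_norm_sub_norm_le _ _).trans (hlip s hs t ht)⟩
end

section
/- Let E and F be real inner product spaces with E finite dimensional, let g : E → ℝ be a convex continuous function, let A : E → F be a linear map, let b ∈ F, and let L > 0. For X ∈ E let T(X) denote the unique minimizer over Y ∈ E of g(Y) + (L/2)‖Y − (X − (1/L) A^*(A X − b))‖², where A^* is the adjoint of A. Then a point X* ∈ E satisfies T(X*) = X* if and only if X* is a minimizer of f(X) := g(X) + (1/2)‖A X − b‖² over E. -/
open RealInnerProductSpace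

/-- A nonnegative perturbation that is homogeneous of degree two does not affect the first-order
optimality condition of a convex function plus a linear functional. -/
theorem ConvexOn.forall_le_add_linear_add_quadratic_iff {V : Type*} [AddCommGroup V] [Module ℝ V]
    {g : V → ℝ} (hg : ConvexOn ℝ Set.univ g) (l : V →ₗ[ℝ] ℝ) {q : V → ℝ}
    (hq_nonneg : ∀ d, 0 ≤ q d) (hq_smul : ∀ (t : ℝ) (d : V), q (t • d) = t ^ 2 * q d) (x : V) :
    (∀ d, g x ≤ g (x + d) + l d + q d) ↔ ∀ d, g x ≤ g (x + d) + l d := by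
  refine ⟨fun h d => ?_, fun h d => (h d).trans (le_add_of_nonneg_right (hq_nonneg d))⟩
  by_contra! hlt
  obtain ⟨δ, hδ⟩ : ∃ δ, δ = g x - (g (x + d) + l d) := ⟨_, rfl⟩
  have hδ_pos : 0 < δ := by linarith
  have hq := hq_nonneg d
  obtain ⟨t, ht⟩ : ∃ t, t = δ / (δ + q d) := ⟨_, rfl⟩
  have ht_pos : 0 < t := by rw [ht]; positivity
  have ht_mul : t * (δ + q d) = δ := by rw [ht]; field_simp
  have ht_le : t ≤ 1 := by rw [ht, div_le_one (by positivity)]; linarith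
  have hconv := hg.2 (Set.mem_univ x) (Set.mem_univ (x + d)) (sub_nonneg.2 ht_le) ht_pos.le
    (sub_add_cancel 1 t)
  have hcomb : (1 - t) • x + t • (x + d) = x + t • d := by module
  rw [hcomb, smul_eq_mul, smul_eq_mul] at hconv
  have hmin := h (t • d)
  rw [hq_smul, map_smul, smul_eq_mul] at hmin
  have hscaled : t * δ ≤ t * (t * q d) := by rw [hδ]; linarith
  have hcancel : δ ≤ t * q d := le_of_mul_le_mul_left hscaled ht_pos
  linarith [mul_pos ht_pos hδ_pos]

/-- Fixed-point characterization of the proximal gradient map: `X*` is a fixed point of the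
proximal gradient step `T` (with step `1/L`, data `A`, adjoint `A*`, and convex continuous
`g`) if and only if `X*` minimizes `f(X) = g(X) + (1/2)‖A X − b‖²`. -/
theorem prox_grad_fixed_point_iff_minimizer
    {E F : Type*} [NormedAddCommGroup E] [InnerProductSpace ℝ E] [FiniteDimensional ℝ E]
    [NormedAddCommGroup F] [InnerProductSpace ℝ F]
    (g : E → ℝ) (hgconv : ConvexOn ℝ Set.univ g) (hgcont : Continuous g)
    (A : E →ₗ[ℝ] F) (Astar : F →ₗ[ℝ] E)
    (hadj : ∀ (x : E) (y : F), ⟪A x, y⟫ = ⟪x, Astar y⟫)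
    (b : F) (L : ℝ) (hL : 0 < L)
    (T : E → E)
    (hT : ∀ X Y : E,
      g (T X) + L / 2 * ‖T X - (X - (1 / L) • Astar (A X - b))‖ ^ 2 ≤
        g Y + L / 2 * ‖Y - (X - (1 / L) • Astar (A X - b))‖ ^ 2)
    (Xstar : E) :
    T Xstar = Xstar ↔
      ∀ X : E, g Xstar + 1 / 2 * ‖A Xstar - b‖ ^ 2 ≤ g X + 1 / 2 * ‖A X - b‖ ^ 2 := by
  set a := Astar (A Xstar - b) with ha
  have hsmooth (d : E) : 1 / 2 * ‖A (Xstar + d) - b‖ ^ 2 =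
      1 / 2 * ‖A Xstar - b‖ ^ 2 + innerₗ E a d + 1 / 2 * ‖A d‖ ^ 2 := by
    rw [map_add, add_sub_right_comm, norm_add_sq_real, innerₗ_apply_apply,
      real_inner_comm (A d), hadj, real_inner_comm a]
    ring
  have hprox (d : E) : L / 2 * ‖Xstar + d - (Xstar - (1 / L) • a)‖ ^ 2 =
      L / 2 * ‖Xstar - (Xstar - (1 / L) • a)‖ ^ 2 + innerₗ E a d + L / 2 * ‖d‖ ^ 2 := by
    rw [add_sub_right_comm, sub_sub_cancel, norm_add_sq_real, innerₗ_apply_apply,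
      real_inner_smul_left]
    field_simp
  have hmin : (∀ X, g Xstar + 1 / 2 * ‖A Xstar - b‖ ^ 2 ≤ g X + 1 / 2 * ‖A X - b‖ ^ 2) ↔
      ∀ d, g Xstar ≤ g (Xstar + d) + innerₗ E a d := by
    rw [← hgconv.forall_le_add_linear_add_quadratic_iff (innerₗ E a)
      (q := fun d => 1 / 2 * ‖A d‖ ^ 2) (fun d => by positivity)
      (fun t d => by rw [map_smul, norm_smul, mul_pow, Real.norm_eq_abs, sq_abs]; ring),
      ← (Equiv.addLeft Xstar).forall_congr_right]
    refine forall_congr' fun d => ?_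
    rw [Equiv.coe_addLeft, hsmooth]
    constructor <;> intro h <;> linarith
  rw [hmin]
  constructor
  · intro hfix
    rw [← hgconv.forall_le_add_linear_add_quadratic_iff (innerₗ E a)
      (q := fun d => L / 2 * ‖d‖ ^ 2) (fun d => by positivity)
      (fun t d => by rw [norm_smul, mul_pow, Real.norm_eq_abs, sq_abs]; ring)]
    intro d
    have h := hT Xstar (Xstar + d)
    rw [hfix, ← ha, hprox] at h
    linarith
  · intro hsub
    have h := hT Xstar Xstar
    have hd := hprox (T Xstar - Xstar)
    have hs := hsub (T Xstar - Xstar)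
    rw [add_sub_cancel] at hd hs
    rw [← ha, hd] at h
    have hsq : L / 2 * ‖T Xstar - Xstar‖ ^ 2 ≤ 0 := by linarith
    have hnorm : ‖T Xstar - Xstar‖ ^ 2 ≤ 0 := nonpos_of_mul_nonpos_right hsq (by positivity)
    exact sub_eq_zero.1 (norm_eq_zero.1 (sq_nonpos_iff _ |>.1 hnorm))
end

section
/- Let E and F be real inner product spaces with E finite dimensional, let g : E → ℝ be a convex continuous function, let A : E → F be a linear map, let b ∈ F, and let L > 0. Fix X ∈ E and suppose T ∈ E minimizes Y ↦ g(Y) + (L/2)‖Y − (X − (1/L) A^*(A X − b))‖² over E, where A^* is the adjoint of A. Define G := L(X − T) + A^*(A T − A X). Then G is a subgradient of f := g + (1/2)‖A · − b‖² at T: for every Y ∈ E, g(Y) + (1/2)‖A Y − b‖² ≥ g(T) + (1/2)‖A T − b‖² + ⟨G, Y − T⟩. -/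
open RealInnerProductSpace

/-- Optimality condition for a proximal point: if `T` minimizes `g + (L/2)‖· − P‖²` with `g`
convex, then `L(P − T)` is a subgradient of `g` at `T`. -/
theorem ConvexOn.add_inner_le_of_isMin_prox
    {E : Type*} [NormedAddCommGroup E] [InnerProductSpace ℝ E]
    {g : E → ℝ} (hg : ConvexOn ℝ Set.univ g) {L : ℝ} (hL : 0 < L) {P T : E}
    (hT : ∀ Y : E, g T + L / 2 * ‖T - P‖ ^ 2 ≤ g Y + L / 2 * ‖Y - P‖ ^ 2) (Y : E) :
    g T + L * ⟪P - T, Y - T⟫ ≤ g Y := by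
  have key : ∀ t : ℝ, 0 < t → t ≤ 1 →
      0 ≤ (g Y - g T - L * ⟪P - T, Y - T⟫) + t * (L / 2 * ‖Y - T‖ ^ 2) := by
    intro t ht0 ht1
    have hconv := hg.2 (Set.mem_univ T) (Set.mem_univ Y) (sub_nonneg.2 ht1) ht0.le (by ring)
    have hmin := hT ((1 - t) • T + t • Y)
    have hdecomp : (1 - t) • T + t • Y - P = t • (Y - T) - (P - T) := by module
    rw [hdecomp, norm_sub_sq_real (t • (Y - T)), norm_smul, mul_pow, Real.norm_eq_abs, sq_abs,
      real_inner_smul_left, real_inner_comm (P - T), norm_sub_rev T P] at hmin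
    simp only [smul_eq_mul] at hconv
    refine nonneg_of_mul_nonneg_right ?_ ht0
    linarith
  have hc : 0 ≤ L / 2 * ‖Y - T‖ ^ 2 := by positivity
  by_contra! hlt
  set s := g Y - g T - L * ⟪P - T, Y - T⟫ with hs
  set c := L / 2 * ‖Y - T‖ ^ 2
  have hs0 : s < 0 := by linarith
  have hcs : 0 < c - s := by linarith
  have h := key (-s / (c - s)) (div_pos (by linarith) hcs) ((div_le_one hcs).2 (by linarith))
  have heq : s + -s / (c - s) * c = -(s ^ 2 / (c - s)) := by
    field_simp
    ring
  have hpos : 0 < s ^ 2 / (c - s) := div_pos (sq_pos_of_neg hs0) hcs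
  linarith

/-- Subgradient residual property: if `T` minimizes the proximal gradient subproblem at `X`,
then `G = L(X − T) + A*(A T − A X)` is a subgradient of `f = g + (1/2)‖A · − b‖²` at `T`. -/
theorem subgradient_residual
    {E F : Type*} [NormedAddCommGroup E] [InnerProductSpace ℝ E] [FiniteDimensional ℝ E]
    [NormedAddCommGroup F] [InnerProductSpace ℝ F]
    (g : E → ℝ) (hgconv : ConvexOn ℝ Set.univ g) (hgcont : Continuous g)
    (A : E →ₗ[ℝ] F) (Astar : F →ₗ[ℝ] E)
    (hadj : ∀ (x : E) (y : F), ⟪A x, y⟫ = ⟪x, Astar y⟫)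
    (b : F) (L : ℝ) (hL : 0 < L)
    (X T : E)
    (hT : ∀ Y : E,
      g T + L / 2 * ‖T - (X - (1 / L) • Astar (A X - b))‖ ^ 2 ≤
        g Y + L / 2 * ‖Y - (X - (1 / L) • Astar (A X - b))‖ ^ 2) :
    ∀ Y : E, g T + 1 / 2 * ‖A T - b‖ ^ 2 + ⟪L • (X - T) + Astar (A T - A X), Y - T⟫ ≤
      g Y + 1 / 2 * ‖A Y - b‖ ^ 2 := by
  intro Y
  have hprox := hgconv.add_inner_le_of_isMin_prox hL hT Y
  have hgrad : L * ⟪X - (1 / L) • Astar (A X - b) - T, Y - T⟫ =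
      ⟪L • (X - T) + Astar (A T - A X), Y - T⟫ - ⟪A T - b, A Y - A T⟫ := by
    have hA : ⟪A T - b, A Y - A T⟫ = ⟪Astar (A T - b), Y - T⟫ := by
      rw [real_inner_comm, ← map_sub, hadj, real_inner_comm]
    rw [hA, ← real_inner_smul_left, ← inner_sub_left]
    congr 1
    simp only [smul_sub, smul_smul, mul_one_div_cancel hL.ne', one_smul, map_sub]
    abel
  have hsq : ‖A Y - b‖ ^ 2 =
      ‖A T - b‖ ^ 2 + 2 * ⟪A T - b, A Y - A T⟫ + ‖A Y - A T‖ ^ 2 := by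
    rw [← norm_add_sq_real]
    congr 2
    abel
  linarith [sq_nonneg ‖A Y - A T‖]
end
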